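/- Let k be a field, n ≥ 1, and let B1, B2 ∈ End_k(k^n) be commuting endomorphisms with a vector ι ∈ k^n satisfying the stability condition: the only subspace S ⊆ k^n invariant under both B1 and B2 and containing ι is k^n itself. Define φ : k[z1, z2] → k^n by φ(f) = f(B1, B2)·ι, where f(B1, B2) denotes the evaluation of f at the commuting pair (B1, B2). Then φ is surjective, its kernel 𝔦 = { f : f(B1, B2)·ι = 0 } is an ideal of k[z1, z2], and dim_k k[z1, z2]/𝔦 = n. -/

import Mathlib

open MvPolynomial

/-- Evaluation of a two-variable polynomial at a commuting pair of endomorphisms: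
`f(B₁,B₂) = Σ_d coeff_d(f) • B₁^{d₀} B₂^{d₁}`, which is the image of `f` under the
unique `k`-algebra homomorphism to the commutative subalgebra generated by
`B₁, B₂` sending `z₁ ↦ B₁`, `z₂ ↦ B₂`. -/
noncomputable def evalPair {k : Type*} [Field k] {n : ℕ}
    (B1 B2 : Module.End k (Fin n → k)) (f : MvPolynomial (Fin 2) k) :
    Module.End k (Fin n → k) :=
  f.support.sum fun d => f.coeff d • (B1 ^ (d 0) * B2 ^ (d 1))

open scoped IsMulCommutative in
/-- For a commuting pair, `evalPair` is given by an algebra homomorphism. -/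
theorem exists_algHom_evalPair {k : Type*} [Field k] {n : ℕ}
    {B1 B2 : Module.End k (Fin n → k)} (hcomm : B1 * B2 = B2 * B1) :
    ∃ Φ : MvPolynomial (Fin 2) k →ₐ[k] Module.End k (Fin n → k),
      (∀ f, Φ f = evalPair B1 B2 f) ∧ Φ (X 0) = B1 ∧ Φ (X 1) = B2 := by
  let s : Set (Module.End k (Fin n → k)) := {B1, B2}
  have : IsMulCommutative (Algebra.adjoin k s) := by
    refine Algebra.isMulCommutative_adjoin k ?_
    rintro x (rfl | rfl) y (rfl | rfl) <;> simp [hcomm]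
  let b : Fin 2 → Algebra.adjoin k s :=
    ![⟨B1, Algebra.subset_adjoin (by simp [s])⟩, ⟨B2, Algebra.subset_adjoin (by simp [s])⟩]
  refine ⟨(Algebra.adjoin k s).val.comp (aeval b), fun f => ?_, ?_, ?_⟩
  · rw [AlgHom.comp_apply, aeval_def, eval₂_eq', map_sum]
    refine Finset.sum_congr rfl fun d _ => ?_
    simp [b, Fin.prod_univ_two, Algebra.smul_def]
  · simp [b]
  · simp [b]

/-- For a stable commuting pair, the orbit of the cyclic vector under polynomials is everything. -/
theorem algHom_apply_surjective_of_stable {k V : Type*} [Field k] [AddCommGroup V] [Module k V]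
    {B1 B2 : Module.End k V} {v : V}
    (hstab : ∀ S : Submodule k V,
      (∀ s ∈ S, B1 s ∈ S) → (∀ s ∈ S, B2 s ∈ S) → v ∈ S → S = ⊤)
    (Φ : MvPolynomial (Fin 2) k →ₐ[k] Module.End k V) (h1 : Φ (X 0) = B1) (h2 : Φ (X 1) = B2) :
    Function.Surjective (LinearMap.applyₗ v ∘ₗ Φ.toLinearMap) := by
  rw [← LinearMap.range_eq_top]
  refine hstab _ ?_ ?_ ⟨1, by simp⟩
  · rintro _ ⟨f, rfl⟩
    exact ⟨X 0 * f, by simp [h1]⟩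
  · rintro _ ⟨f, rfl⟩
    exact ⟨X 1 * f, by simp [h2]⟩

/-- For a stable commuting pair `(B₁, B₂, ι)`, the map `φ(f) = f(B₁,B₂)·ι` is
surjective and its kernel is an ideal of codimension `n` in `k[z₁,z₂]`. -/
theorem surjective_eval_of_stable
    (k : Type*) [Field k] (n : ℕ) (hn : 1 ≤ n)
    (B1 B2 : Module.End k (Fin n → k)) (hcomm : B1 * B2 = B2 * B1)
    (ι : Fin n → k)
    (hstab : ∀ S : Submodule k (Fin n → k),
      (∀ s ∈ S, B1 s ∈ S) → (∀ s ∈ S, B2 s ∈ S) → ι ∈ S → S = ⊤) :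
    Function.Surjective (fun f : MvPolynomial (Fin 2) k => evalPair B1 B2 f ι) ∧
    ∃ 𝔦 : Ideal (MvPolynomial (Fin 2) k),
      (∀ f, f ∈ 𝔦 ↔ evalPair B1 B2 f ι = 0) ∧
      Module.finrank k (MvPolynomial (Fin 2) k ⧸ 𝔦) = n := by
  obtain ⟨Φ, hΦ, h1, h2⟩ := exists_algHom_evalPair hcomm
  have hsurj := algHom_apply_surjective_of_stable hstab Φ h1 h2
  set φ := LinearMap.applyₗ ι ∘ₗ Φ.toLinearMap
  have hφ (f) : φ f = evalPair B1 B2 f ι := by simp [φ, ← hΦ]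
  refine ⟨fun x => (hsurj x).imp fun f hf => (hφ f).symm.trans hf, ?_⟩
  let I : Ideal (MvPolynomial (Fin 2) k) :=
    { LinearMap.ker φ with
      smul_mem' := fun c f hf => by
        have hf' : Φ f ι = 0 := hf
        change Φ (c * f) ι = 0
        rw [map_mul, Module.End.mul_apply, hf', map_zero] }
  refine ⟨I, fun f => ?_, ?_⟩
  · rw [← hφ]
    rfl
  · have e : (MvPolynomial (Fin 2) k ⧸ LinearMap.ker φ) ≃ₗ[k] MvPolynomial (Fin 2) k ⧸ I :=
      Submodule.Quotient.restrictScalarsEquiv k I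
    rw [← e.finrank_eq, (φ.quotKerEquivOfSurjective hsurj).finrank_eq, Module.finrank_fin_fun]
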